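/- There exists a constant R>0 such that for all finite words 𝔦∈𝓘* and all a,b∈[0,1]², R⁻¹ ≤ f_{𝔦,x}(a)/f_{𝔦,x}(b) ≤ R and R⁻¹ ≤ g_{𝔦,y}(a)/g_{𝔦,y}(b) ≤ R. -/

import Mathlib

/-!
Setting (Falconer–Fraser–Lee, "L^q-spectra of measures on planar non-conformal attractors"):
a finite family of C^{1+α} skew-product contractions
`S i (x,y) = (f i x, g i (x,y))` of the unit square, satisfying a domination
condition on the (lower triangular) Jacobians.
-/

open Set Filter Topology MeasureTheory
open scoped Classical ENNReal

noncomputable section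

/-- The closed unit square `[0,1]² ⊆ ℝ²`. -/
def unitSq : Set (ℝ × ℝ) := Set.Icc (0:ℝ) 1 ×ˢ Set.Icc (0:ℝ) 1

variable {ι : Type*} [Fintype ι]

/-- The skew-product map `S_i(x,y) = (f_i x, g_i (x,y))`. -/
def Smap (f : ι → ℝ → ℝ) (g : ι → ℝ × ℝ → ℝ) (i : ι) : ℝ × ℝ → ℝ × ℝ :=
  fun a => (f i a.1, g i a)

/-- The composition `S_𝔦 = S_{i₁} ∘ ⋯ ∘ S_{i_k}` along a finite word `𝔦 = [i₁, …, i_k]`. -/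
def Sword (f : ι → ℝ → ℝ) (g : ι → ℝ × ℝ → ℝ) : List ι → ℝ × ℝ → ℝ × ℝ
  | [] => id
  | i :: l => Smap f g i ∘ Sword f g l

/-- The first component `f_𝔦 = f_{i₁} ∘ ⋯ ∘ f_{i_k}` of `S_𝔦` (a function of `x` only). -/
def fword (f : ι → ℝ → ℝ) : List ι → ℝ → ℝ
  | [] => id
  | i :: l => f i ∘ fword f l

/-- Top-left entry `f_{𝔦,x}(a)` of the (lower triangular) Jacobian `D_a S_𝔦`. -/
def fxw (f : ι → ℝ → ℝ) (g : ι → ℝ × ℝ → ℝ) (l : List ι) (a : ℝ × ℝ) : ℝ :=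
  deriv (fun x => (Sword f g l (x, a.2)).1) a.1

/-- Bottom-left entry `g_{𝔦,x}(a)` of the Jacobian `D_a S_𝔦`. -/
def gxw (f : ι → ℝ → ℝ) (g : ι → ℝ × ℝ → ℝ) (l : List ι) (a : ℝ × ℝ) : ℝ :=
  deriv (fun x => (Sword f g l (x, a.2)).2) a.1

/-- Bottom-right entry `g_{𝔦,y}(a)` of the Jacobian `D_a S_𝔦`. -/
def gyw (f : ι → ℝ → ℝ) (g : ι → ℝ × ℝ → ℝ) (l : List ι) (a : ℝ × ℝ) : ℝ :=
  deriv (fun y => (Sword f g l (a.1, y)).2) a.2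

/-- The standing hypotheses: `|𝓘| ≥ 2`; each `S_i(x,y) = (f_i x, g_i(x,y))` maps the unit
square into itself; `f_i, g_i` are `C^{1+α}` contractions (`0 < α ≤ 1`); and the
domination condition `inf f_{i,x} > sup g_{i,y} ≥ inf g_{i,y} ≥ d > 0` holds. -/
structure IFSHyp (f : ι → ℝ → ℝ) (g : ι → ℝ × ℝ → ℝ) (α d : ℝ) : Prop where
  card2 : 2 ≤ Fintype.card ι
  alpha_pos : 0 < α
  alpha_le_one : α ≤ 1
  d_pos : 0 < d
  maps_f : ∀ i, Set.MapsTo (f i) (Set.Icc 0 1) (Set.Icc 0 1)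
  maps_g : ∀ i, Set.MapsTo (g i) unitSq (Set.Icc 0 1)
  diff_f : ∀ i, Differentiable ℝ (f i)
  diff_g : ∀ i, Differentiable ℝ (g i)
  holder_f : ∀ i, ∃ H : ℝ, ∀ x ∈ Set.Icc (0:ℝ) 1, ∀ y ∈ Set.Icc (0:ℝ) 1,
      |deriv (f i) x - deriv (f i) y| ≤ H * |x - y| ^ α
  holder_g : ∀ i, ∃ H : ℝ, ∀ a ∈ unitSq, ∀ b ∈ unitSq,
      ‖fderiv ℝ (g i) a - fderiv ℝ (g i) b‖ ≤ H * ‖a - b‖ ^ α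
  contr_f : ∀ i, ∃ c, 0 ≤ c ∧ c < 1 ∧ ∀ x ∈ Set.Icc (0:ℝ) 1, ∀ y ∈ Set.Icc (0:ℝ) 1,
      |f i x - f i y| ≤ c * |x - y|
  contr_g : ∀ i, ∃ c, 0 ≤ c ∧ c < 1 ∧ ∀ a ∈ unitSq, ∀ b ∈ unitSq,
      |g i a - g i b| ≤ c * ‖a - b‖
  dom : ∀ i, sSup (gyw f g [i] '' unitSq) < sInf (fxw f g [i] '' unitSq)
  dom_d : ∀ i, ∀ a ∈ unitSq, d ≤ gyw f g [i] a

/-- The larger singular value of the lower triangular matrix `A = [[a,0],[b,c]]`, i.e. the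
square root of the larger eigenvalue of `AᵀA`, in explicit closed form. -/
def sv1 (a b c : ℝ) : ℝ :=
  Real.sqrt (((a ^ 2 + b ^ 2 + c ^ 2) +
    Real.sqrt ((a ^ 2 + b ^ 2 + c ^ 2) ^ 2 - 4 * (a * c) ^ 2)) / 2)

/-- The smaller singular value of the lower triangular matrix `A = [[a,0],[b,c]]`, i.e. the
square root of the smaller eigenvalue of `AᵀA`, in explicit closed form. -/
def sv2 (a b c : ℝ) : ℝ :=
  Real.sqrt (((a ^ 2 + b ^ 2 + c ^ 2) -
    Real.sqrt ((a ^ 2 + b ^ 2 + c ^ 2) ^ 2 - 4 * (a * c) ^ 2)) / 2)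

/-- `α₁(D_a S_𝔦)`, the larger singular value of the Jacobian. -/
def alphaOne (f : ι → ℝ → ℝ) (g : ι → ℝ × ℝ → ℝ) (l : List ι) (a : ℝ × ℝ) : ℝ :=
  sv1 (fxw f g l a) (gxw f g l a) (gyw f g l a)

/-- `α₂(D_a S_𝔦)`, the smaller singular value of the Jacobian. -/
def alphaTwo (f : ι → ℝ → ℝ) (g : ι → ℝ × ℝ → ℝ) (l : List ι) (a : ℝ × ℝ) : ℝ :=
  sv2 (fxw f g l a) (gxw f g l a) (gyw f g l a)

/-- `η = sup_{i, a, b} g_{i,y}(a) / f_{i,x}(b)`. -/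
def etaSup (f : ι → ℝ → ℝ) (g : ι → ℝ × ℝ → ℝ) : ℝ :=
  sSup {x : ℝ | ∃ i : ι, ∃ a ∈ unitSq, ∃ b ∈ unitSq, x = gyw f g [i] a / fxw f g [i] b}

/-- `p(𝔦) = p_{i₁} ⋯ p_{i_k}`. -/
def pword (p : ι → ℝ) (l : List ι) : ℝ := (l.map p).prod

/-- `(p_i)` is a probability vector with all entries in `(0,1)`. -/
def ProbVec (p : ι → ℝ) : Prop := (∀ i, 0 < p i ∧ p i < 1) ∧ ∑ i, p i = 1

/-- The `q`-modified singular value function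
`ψ^{s,q}_a(𝔦) = p(𝔦)^q α₁(D_aS_𝔦)^βq α₂(D_aS_𝔦)^(s−βq)` (real exponents). -/
def psiSV (f : ι → ℝ → ℝ) (g : ι → ℝ × ℝ → ℝ) (p : ι → ℝ) (s q βq : ℝ)
    (a : ℝ × ℝ) (l : List ι) : ℝ :=
  pword p l ^ q * alphaOne f g l a ^ βq * alphaTwo f g l a ^ (s - βq)

/-- `Ψ^{s,q}_{a,k} = Σ_{𝔦 ∈ 𝓘^k} ψ^{s,q}_a(𝔦)`. -/
def PsiSum (f : ι → ℝ → ℝ) (g : ι → ℝ × ℝ → ℝ) (p : ι → ℝ) (s q βq : ℝ)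
    (a : ℝ × ℝ) (k : ℕ) : ℝ :=
  ∑ w : Fin k → ι, psiSV f g p s q βq a (List.ofFn w)

/-- The `δ`-stopping `𝓘_{a,δ} = {𝔦 : α₂(D_aS_𝔦) < δ ≤ α₂(D_aS_𝔦̂)}`, where `𝔦̂` drops the
last letter of `𝔦`. -/
def stopping (f : ι → ℝ → ℝ) (g : ι → ℝ × ℝ → ℝ) (a : ℝ × ℝ) (δ : ℝ) : Set (List ι) :=
  {l | l ≠ [] ∧ alphaTwo f g l a < δ ∧ δ ≤ alphaTwo f g l.dropLast a}

/-- `q`-th power moment sum of a measure on `ℝ` over the `δ`-mesh intervals of positive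
measure. -/
def msum1 (ν : Measure ℝ) (q δ : ℝ) : ℝ :=
  ∑' k : ℤ, if 0 < ν (Set.Icc ((k : ℝ) * δ) (((k : ℝ) + 1) * δ)) then
    (ν (Set.Icc ((k : ℝ) * δ) (((k : ℝ) + 1) * δ))).toReal ^ q else 0

/-- `q`-th power moment sum of a measure on `ℝ²` over the `δ`-mesh squares of positive
measure. -/
def msum2 (ν : Measure (ℝ × ℝ)) (q δ : ℝ) : ℝ :=
  ∑' k : ℤ × ℤ,
    if 0 < ν (Set.Icc ((k.1 : ℝ) * δ) (((k.1 : ℝ) + 1) * δ) ×ˢ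
        Set.Icc ((k.2 : ℝ) * δ) (((k.2 : ℝ) + 1) * δ)) then
      (ν (Set.Icc ((k.1 : ℝ) * δ) (((k.1 : ℝ) + 1) * δ) ×ˢ
        Set.Icc ((k.2 : ℝ) * δ) (((k.2 : ℝ) + 1) * δ))).toReal ^ q else 0

/-- Upper `L^q`-spectrum of a measure on `ℝ²`. -/
def upperTau2 (ν : Measure (ℝ × ℝ)) (q : ℝ) : ℝ :=
  limsup (fun δ => Real.log (msum2 ν q δ) / (-Real.log δ)) (𝓝[>] (0:ℝ))

/-- Lower `L^q`-spectrum of a measure on `ℝ²`. -/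
def lowerTau2 (ν : Measure (ℝ × ℝ)) (q : ℝ) : ℝ :=
  liminf (fun δ => Real.log (msum2 ν q δ) / (-Real.log δ)) (𝓝[>] (0:ℝ))

theorem Sword_fst {ι : Type*} (f : ι → ℝ → ℝ) (g : ι → ℝ × ℝ → ℝ) (l : List ι) (a : ℝ × ℝ) :
    (Sword f g l a).1 = fword f l a.1 := by
  induction l with
  | nil => rfl
  | cons i l ih => simp [Sword, fword, Smap, ih]

theorem fxw_nil {ι : Type*} (f : ι → ℝ → ℝ) (g : ι → ℝ × ℝ → ℝ) (a : ℝ × ℝ) : fxw f g [] a = 1 := by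
  simp [fxw, Sword]

theorem gyw_nil {ι : Type*} (f : ι → ℝ → ℝ) (g : ι → ℝ × ℝ → ℝ) (a : ℝ × ℝ) : gyw f g [] a = 1 := by
  simp [gyw, Sword]

theorem fxw_singleton {ι : Type*} (f : ι → ℝ → ℝ) (g : ι → ℝ × ℝ → ℝ) (i : ι) (a : ℝ × ℝ) :
    fxw f g [i] a = deriv (f i) a.1 := rfl

theorem gyw_singleton {ι : Type*} {f : ι → ℝ → ℝ} {g : ι → ℝ × ℝ → ℝ} (hg : ∀ i, Differentiable ℝ (g i))
    (i : ι) (a : ℝ × ℝ) : gyw f g [i] a = fderiv ℝ (g i) a (0, 1) :=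
  (((hg i a).hasFDerivAt).comp_hasDerivAt a.2
    ((hasDerivAt_const a.2 a.1).prodMk (hasDerivAt_id a.2))).deriv

theorem differentiable_fword {ι : Type*} {f : ι → ℝ → ℝ} (hf : ∀ i, Differentiable ℝ (f i)) (l : List ι) :
    Differentiable ℝ (fword f l) := by
  induction l with
  | nil => exact differentiable_id
  | cons i l ih => exact (hf i).comp ih

theorem differentiable_Sword {ι : Type*} {f : ι → ℝ → ℝ} {g : ι → ℝ × ℝ → ℝ}
    (hf : ∀ i, Differentiable ℝ (f i)) (hg : ∀ i, Differentiable ℝ (g i)) (l : List ι) :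
    Differentiable ℝ (Sword f g l) := by
  induction l with
  | nil => exact differentiable_id
  | cons i l ih =>
    exact Differentiable.comp (((hf i).comp differentiable_fst).prodMk (hg i)) ih

/-- Chain rule for the top-left entry of the Jacobian. -/
theorem fxw_cons {ι : Type*} {f : ι → ℝ → ℝ} (g : ι → ℝ × ℝ → ℝ) (hf : ∀ i, Differentiable ℝ (f i))
    (i : ι) (l : List ι) (a : ℝ × ℝ) :
    fxw f g (i :: l) a = fxw f g [i] (Sword f g l a) * fxw f g l a := by
  have hfst : ∀ l', (fun x => (Sword f g l' (x, a.2)).1) = fword f l' :=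
    fun l' => funext fun x => Sword_fst f g l' (x, a.2)
  rw [fxw_singleton, Sword_fst, fxw, fxw, hfst, hfst]
  exact deriv_comp a.1 (hf i _) (differentiable_fword hf l _)

/-- Chain rule for the bottom-right entry of the Jacobian. -/
theorem gyw_cons {ι : Type*} {f : ι → ℝ → ℝ} {g : ι → ℝ × ℝ → ℝ} (hf : ∀ i, Differentiable ℝ (f i))
    (hg : ∀ i, Differentiable ℝ (g i)) (i : ι) (l : List ι) (a : ℝ × ℝ) :
    gyw f g (i :: l) a = gyw f g [i] (Sword f g l a) * gyw f g l a := by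
  have hsnd : HasDerivAt (fun y => (Sword f g l (a.1, y)).2) (gyw f g l a) a.2 := by
    refine DifferentiableAt.hasDerivAt ?_
    have := differentiable_Sword hf hg l
    fun_prop
  have hS : HasDerivAt (fun y => Sword f g l (a.1, y)) (0, gyw f g l a) a.2 := by
    refine ((hasDerivAt_const a.2 (fword f l a.1)).prodMk hsnd).congr_of_eventuallyEq
      (Eventually.of_forall fun y => ?_)
    exact Prod.ext (Sword_fst f g l (a.1, y)) rfl
  have key : gyw f g (i :: l) a = fderiv ℝ (g i) (Sword f g l a) (0, gyw f g l a) :=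
    (((hg i (Sword f g l a)).hasFDerivAt).comp_hasDerivAt a.2 hS).deriv
  have hsmul : ((0, gyw f g l a) : ℝ × ℝ) = gyw f g l a • ((0, 1) : ℝ × ℝ) := by simp
  rw [key, gyw_singleton hg, hsmul, map_smul, smul_eq_mul, mul_comm]

theorem norm_sub_le_one_of_mem_unitSq {a b : ℝ × ℝ} (ha : a ∈ unitSq) (hb : b ∈ unitSq) :
    ‖a - b‖ ≤ 1 := by
  obtain ⟨⟨h1, h2⟩, h3, h4⟩ := ha
  obtain ⟨⟨h5, h6⟩, h7, h8⟩ := hb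
  refine norm_prod_le_iff.2 ⟨?_, ?_⟩ <;> rw [Real.norm_eq_abs, abs_le] <;>
    constructor <;> simp <;> linarith

theorem isBounded_image_unitSq {D : ℝ × ℝ → ℝ} {H α : ℝ} (hH : 0 ≤ H) (hα : 0 ≤ α)
    (hD : ∀ a ∈ unitSq, ∀ b ∈ unitSq, |D a - D b| ≤ H * ‖a - b‖ ^ α) :
    Bornology.IsBounded (D '' unitSq) := by
  refine Metric.isBounded_iff.2 ⟨H, ?_⟩
  rintro _ ⟨a, ha, rfl⟩ _ ⟨b, hb, rfl⟩
  refine (hD a ha b hb).trans (mul_le_of_le_one_right hH ?_)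
  exact Real.rpow_le_one (norm_nonneg _) (norm_sub_le_one_of_mem_unitSq ha hb) hα

/-- Bounded distortion for a multiplicative cocycle over the words of an iterated function system
whose generators `D i` are Hölder continuous and bounded below by a positive constant. -/
theorem cocycle_pos_and_le_mul_exp {ι : Type*} {X : Type*} [SeminormedAddCommGroup X] {s : Set X}
    {S : List ι → X → X} {D : ι → X → ℝ} {u : List ι → X → ℝ} {H α d c : ℝ}
    (hH : 0 ≤ H) (hα : 0 < α) (hd : 0 < d) (hc : 0 ≤ c) (hc1 : c < 1)
    (hS : ∀ l, MapsTo (S l) s s)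
    (hS_contr : ∀ l, ∀ a ∈ s, ∀ b ∈ s, ‖S l a - S l b‖ ≤ c ^ l.length)
    (hD : ∀ i, ∀ a ∈ s, ∀ b ∈ s, |D i a - D i b| ≤ H * ‖a - b‖ ^ α)
    (hDd : ∀ i, ∀ a ∈ s, d ≤ D i a)
    (hu_nil : ∀ a, u [] a = 1) (hu_cons : ∀ i l a, u (i :: l) a = D i (S l a) * u l a)
    (l : List ι) {a b : X} (ha : a ∈ s) (hb : b ∈ s) :
    0 < u l a ∧ u l a ≤ u l b * Real.exp (H / d * (1 - c ^ α)⁻¹) := by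
  have hpos : ∀ l : List ι, ∀ a ∈ s, 0 < u l a := by
    intro l a ha
    induction l with
    | nil => simp [hu_nil]
    | cons i l ih => exact hu_cons i l a ▸ mul_pos (hd.trans_le (hDd i _ (hS l ha))) ih
  have hρ : 0 ≤ c ^ α := Real.rpow_nonneg hc α
  have hρ1 : c ^ α < 1 := Real.rpow_lt_one hc hc1 hα
  have hsum : u l a ≤ u l b * Real.exp (H / d * ∑ j ∈ Finset.range l.length, (c ^ α) ^ j) := by
    induction l with
    | nil => simp [hu_nil]
    | cons i l ih =>
      have hva := hDd i _ (hS l ha)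
      have hvb := hDd i _ (hS l hb)
      have hpow : ‖S l a - S l b‖ ^ α ≤ (c ^ α) ^ l.length := by
        rw [Real.rpow_pow_comm hc]
        exact Real.rpow_le_rpow (norm_nonneg _) (hS_contr l a ha b hb) hα.le
      have hdiff : D i (S l a) ≤ D i (S l b) + H * (c ^ α) ^ l.length := by
        linarith [le_of_abs_le (hD i _ (hS l ha) _ (hS l hb)), mul_le_mul_of_nonneg_left hpow hH]
      have hstep : D i (S l a) ≤ D i (S l b) * Real.exp (H / d * (c ^ α) ^ l.length) := by
        have hexp := Real.add_one_le_exp (H / d * (c ^ α) ^ l.length)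
        have ht : 0 ≤ H / d * (c ^ α) ^ l.length := by positivity
        have hdt : d * (H / d * (c ^ α) ^ l.length) = H * (c ^ α) ^ l.length := by field_simp
        nlinarith [mul_le_mul_of_nonneg_right hvb ht,
          mul_le_mul_of_nonneg_left hexp (hd.le.trans hvb)]
      rw [hu_cons, hu_cons, List.length_cons, Finset.sum_range_succ, mul_add, Real.exp_add]
      calc D i (S l a) * u l a
          ≤ (D i (S l b) * Real.exp (H / d * (c ^ α) ^ l.length)) *
            (u l b * Real.exp (H / d * ∑ j ∈ Finset.range l.length, (c ^ α) ^ j)) :=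
          mul_le_mul hstep ih (hpos l a ha).le ((hd.le.trans hva).trans hstep)
        _ = _ := by ring
  refine ⟨hpos l a ha, hsum.trans ?_⟩
  gcongr
  · exact (hpos l b hb).le
  · exact tsum_geometric_of_lt_one hρ hρ1 ▸
      (summable_geometric_of_lt_one hρ hρ1).sum_le_tsum _ fun j _ => pow_nonneg hρ j

theorem inv_le_div_and_div_le {x y R : ℝ} (hy : 0 < y) (hR : 0 < R)
    (hxy : x ≤ y * R) (hyx : y ≤ x * R) : R⁻¹ ≤ x / y ∧ x / y ≤ R := by
  constructor
  · rw [le_div_iff₀ hy, inv_mul_le_iff₀ hR]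
    linarith
  · rw [div_le_iff₀ hy]
    linarith

namespace IFSHyp

variable {f : ι → ℝ → ℝ} {g : ι → ℝ × ℝ → ℝ} {α d : ℝ}

theorem mapsTo_Sword (h : IFSHyp f g α d) (l : List ι) : MapsTo (Sword f g l) unitSq unitSq := by
  induction l with
  | nil => exact mapsTo_id _
  | cons i l ih => exact fun a ha => ⟨h.maps_f i (ih ha).1, h.maps_g i (ih ha)⟩

/-- A common contraction ratio for all words. -/
theorem exists_norm_Sword_sub_le (h : IFSHyp f g α d) :
    ∃ c : ℝ, 0 ≤ c ∧ c < 1 ∧ ∀ l, ∀ a ∈ unitSq, ∀ b ∈ unitSq,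
      ‖Sword f g l a - Sword f g l b‖ ≤ c ^ l.length := by
  have hne : Nonempty ι := Fintype.card_pos_iff.1 (by have := h.card2; omega)
  choose c hc0 hc1 hc using h.contr_f
  choose e he0 he1 he using h.contr_g
  obtain ⟨i₀, hi₀⟩ := Finite.exists_max fun i => max (c i) (e i)
  refine ⟨max (c i₀) (e i₀), le_max_of_le_left (hc0 _), max_lt (hc1 _) (he1 _), fun l => ?_⟩
  induction l with
  | nil => exact fun a ha b hb => by simpa [Sword] using norm_sub_le_one_of_mem_unitSq ha hb
  | cons i l ih =>
    intro a ha b hb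
    have ha' := h.mapsTo_Sword l ha
    have hb' := h.mapsTo_Sword l hb
    have hM := (hc0 i₀).trans (le_max_left (c i₀) (e i₀))
    rw [List.length_cons, pow_succ']
    refine le_trans ?_ (mul_le_mul_of_nonneg_left (ih a ha b hb) hM)
    refine norm_prod_le_iff.2 ⟨?_, ?_⟩
    · refine (hc i _ ha'.1 _ hb'.1).trans ?_
      exact mul_le_mul ((le_max_left _ _).trans (hi₀ i))
        (norm_fst_le (Sword f g l a - Sword f g l b)) (abs_nonneg _) hM
    · refine (he i _ ha' _ hb').trans ?_
      exact mul_le_mul_of_nonneg_right ((le_max_right _ _).trans (hi₀ i)) (norm_nonneg _)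

/-- A common Hölder constant for the diagonal entries of the Jacobians of the generators. -/
theorem exists_holder_const (h : IFSHyp f g α d) :
    ∃ H : ℝ, 0 ≤ H ∧ ∀ i, ∀ a ∈ unitSq, ∀ b ∈ unitSq,
      |fxw f g [i] a - fxw f g [i] b| ≤ H * ‖a - b‖ ^ α ∧
      |gyw f g [i] a - gyw f g [i] b| ≤ H * ‖a - b‖ ^ α := by
  choose F hF using h.holder_f
  choose G hG using h.holder_g
  have hle : ∀ i, |F i| ≤ ∑ j, (|F j| + |G j|) ∧ |G i| ≤ ∑ j, (|F j| + |G j|) := by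
    intro i
    have := Finset.single_le_sum (f := fun j => |F j| + |G j|)
      (fun j _ => by positivity) (Finset.mem_univ i)
    exact ⟨(le_add_of_nonneg_right (abs_nonneg _)).trans this,
      (le_add_of_nonneg_left (abs_nonneg _)).trans this⟩
  refine ⟨∑ j, (|F j| + |G j|), Finset.sum_nonneg fun j _ => by positivity,
    fun i a ha b hb => ⟨?_, ?_⟩⟩
  · rw [fxw_singleton, fxw_singleton]
    refine (hF i _ ha.1 _ hb.1).trans ?_
    refine mul_le_mul ((le_abs_self _).trans (hle i).1) ?_ (by positivity)
      ((abs_nonneg _).trans (hle i).1)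
    exact Real.rpow_le_rpow (abs_nonneg _) (norm_fst_le (a - b)) h.alpha_pos.le
  · rw [gyw_singleton h.diff_g, gyw_singleton h.diff_g]
    have hnorm : ‖((0, 1) : ℝ × ℝ)‖ = 1 := by simp [Prod.norm_def]
    calc |fderiv ℝ (g i) a (0, 1) - fderiv ℝ (g i) b (0, 1)|
        ≤ ‖fderiv ℝ (g i) a - fderiv ℝ (g i) b‖ * ‖((0, 1) : ℝ × ℝ)‖ :=
          (fderiv ℝ (g i) a - fderiv ℝ (g i) b).le_opNorm (0, 1)
      _ ≤ G i * ‖a - b‖ ^ α := by simpa [hnorm] using hG i a ha b hb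
      _ ≤ _ := mul_le_mul_of_nonneg_right ((le_abs_self _).trans (hle i).2) (by positivity)

theorem le_fxw_singleton (h : IFSHyp f g α d) (i : ι) {a : ℝ × ℝ} (ha : a ∈ unitSq) :
    d ≤ fxw f g [i] a := by
  obtain ⟨H, hH, hHol⟩ := h.exists_holder_const
  have hf := isBounded_image_unitSq hH h.alpha_pos.le fun a ha b hb => (hHol i a ha b hb).1
  have hg := isBounded_image_unitSq hH h.alpha_pos.le fun a ha b hb => (hHol i a ha b hb).2
  calc d ≤ gyw f g [i] a := h.dom_d i a ha
    _ ≤ sSup (gyw f g [i] '' unitSq) := le_csSup hg.bddAbove (mem_image_of_mem _ ha)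
    _ ≤ sInf (fxw f g [i] '' unitSq) := (h.dom i).le
    _ ≤ fxw f g [i] a := csInf_le hf.bddBelow (mem_image_of_mem _ ha)

end IFSHyp

theorem bounded_distortion_diagonal {ι : Type*} [Fintype ι]
    (f : ι → ℝ → ℝ) (g : ι → ℝ × ℝ → ℝ) (α d : ℝ) (h : IFSHyp f g α d) :
    ∃ R : ℝ, 0 < R ∧ ∀ l : List ι, l ≠ [] → ∀ a ∈ unitSq, ∀ b ∈ unitSq,
      (R⁻¹ ≤ fxw f g l a / fxw f g l b ∧ fxw f g l a / fxw f g l b ≤ R) ∧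
      (R⁻¹ ≤ gyw f g l a / gyw f g l b ∧ gyw f g l a / gyw f g l b ≤ R) := by
  obtain ⟨c, hc, hc1, hS⟩ := h.exists_norm_Sword_sub_le
  obtain ⟨H, hH, hHol⟩ := h.exists_holder_const
  have hfx := fun l {a b} => cocycle_pos_and_le_mul_exp (u := fxw f g) (a := a) (b := b)
    hH h.alpha_pos h.d_pos hc hc1 h.mapsTo_Sword hS (fun i a ha b hb => (hHol i a ha b hb).1)
    (fun i a ha => h.le_fxw_singleton i ha) (fxw_nil f g) (fxw_cons g h.diff_f) l
  have hgy := fun l {a b} => cocycle_pos_and_le_mul_exp (u := gyw f g) (a := a) (b := b)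
    hH h.alpha_pos h.d_pos hc hc1 h.mapsTo_Sword hS (fun i a ha b hb => (hHol i a ha b hb).2)
    h.dom_d (gyw_nil f g) (gyw_cons h.diff_f h.diff_g) l
  refine ⟨Real.exp (H / d * (1 - c ^ α)⁻¹), Real.exp_pos _, fun l _ a ha b hb => ⟨?_, ?_⟩⟩
  · exact inv_le_div_and_div_le (hfx l hb ha).1 (Real.exp_pos _)
      (hfx l ha hb).2 (hfx l hb ha).2
  · exact inv_le_div_and_div_le (hgy l hb ha).1 (Real.exp_pos _)
      (hgy l ha hb).2 (hgy l hb ha).2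

end
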